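/- arXiv:1006.2026 — 7 statements merged into one kernel-verified Lean document; each statement's English description precedes it below -/
import Mathlib

section
/- Let m ≥ 1 and b ≥ 0 be integers, and let d̲_i = i·m and d̄_i = i·m + b for 0 ≤ i ≤ p. Then the Boij-Söderberg poset Π_{d̲,d̄} is isomorphic to its own order dual; explicitly, the map sending d to the sequence i ↦ p·m + b − d_{p−i} is a bijection of Π_{d̲,d̄} onto itself satisfying d ≤ e if and only if ψ(e) ≤ ψ(d). -/
/-- The Boij-Söderberg poset `Π_{d̲,d̄}`: strictly increasing sequences
`d : Fin (p+1) → ℤ` with `d̲ᵢ ≤ dᵢ ≤ d̄ᵢ`, ordered componentwise (as a subset of the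
product order on `Fin (p+1) → ℤ`). -/
def BSPoset (p : ℕ) (dl du : Fin (p+1) → ℤ) : Set (Fin (p+1) → ℤ) :=
  {d | StrictMono d ∧ ∀ i, dl i ≤ d i ∧ d i ≤ du i}

/-- Reverse a sequence and subtract each entry from `c`. -/
def reflectSeq {n : ℕ} (c : ℤ) (d : Fin n → ℤ) : Fin n → ℤ := fun i => c - d i.rev

theorem reflectSeq_involutive {n : ℕ} (c : ℤ) :
    Function.Involutive (reflectSeq (n := n) c) := fun d => by
  funext i
  simp [reflectSeq]

theorem reflectSeq_le_reflectSeq_iff {n : ℕ} (c : ℤ) (d e : Fin n → ℤ) :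
    reflectSeq c e ≤ reflectSeq c d ↔ d ≤ e := by
  simp only [Pi.le_def, reflectSeq, sub_le_sub_iff_left]
  exact Fin.revPerm.forall_congr_right (q := fun i => d i ≤ e i)

theorem StrictMono.reflectSeq {n : ℕ} {d : Fin n → ℤ} (hd : StrictMono d) (c : ℤ) :
    StrictMono (reflectSeq c d) := fun _ _ hij =>
  sub_lt_sub_left (hd (Fin.rev_lt_rev.2 hij)) c

theorem mapsTo_reflectSeq_BSPoset {p : ℕ} {dl du : Fin (p + 1) → ℤ} {c : ℤ}
    (h : ∀ i, dl i + du i.rev = c) :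
    Set.MapsTo (reflectSeq c) (BSPoset p dl du) (BSPoset p dl du) := by
  rintro d ⟨hd, hbd⟩
  refine ⟨hd.reflectSeq c, fun i => ?_⟩
  have hi := h i
  have hr := h i.rev
  rw [Fin.rev_rev] at hr
  have := hbd i.rev
  simp only [reflectSeq]
  constructor <;> linarith

/-- Reflection as an isomorphism from the order dual of a Boij-Söderberg poset with symmetric
bounds to the poset itself. -/
def reflectBSPosetIso {p : ℕ} {dl du : Fin (p + 1) → ℤ} {c : ℤ}
    (h : ∀ i, dl i + du i.rev = c) : (BSPoset p dl du)ᵒᵈ ≃o BSPoset p dl du where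
  toFun d := (mapsTo_reflectSeq_BSPoset h).restrict _ _ _ (OrderDual.ofDual d)
  invFun d := OrderDual.toDual ((mapsTo_reflectSeq_BSPoset h).restrict _ _ _ d)
  left_inv d := Subtype.ext (reflectSeq_involutive c (OrderDual.ofDual d).1)
  right_inv d := Subtype.ext (reflectSeq_involutive c d.1)
  map_rel_iff' {d e} :=
    reflectSeq_le_reflectSeq_iff c (OrderDual.ofDual e).1 (OrderDual.ofDual d).1

theorem stmt_4 (p : ℕ) (m b : ℤ) (hm : 1 ≤ m) (hb : 0 ≤ b) :
    let dl : Fin (p+1) → ℤ := fun i => (i : ℕ) * m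
    let du : Fin (p+1) → ℤ := fun i => (i : ℕ) * m + b
    let ψ : (Fin (p+1) → ℤ) → Fin (p+1) → ℤ := fun d i => p * m + b - d i.rev
    Set.BijOn ψ (BSPoset p dl du) (BSPoset p dl du) ∧
    (∀ d ∈ BSPoset p dl du, ∀ e ∈ BSPoset p dl du,
      ((∀ i, d i ≤ e i) ↔ ∀ i, ψ e i ≤ ψ d i)) ∧
    Nonempty ((BSPoset p dl du)ᵒᵈ ≃o BSPoset p dl du) := by
  intro dl du ψ
  have h : ∀ i, dl i + du i.rev = p * m + b := fun i => by
    have hi : ((i : ℕ) : ℤ) + (i.rev : ℕ) = p := by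
      rw [Fin.val_rev]
      omega
    simp only [dl, du, ← hi]
    ring
  have hmaps := mapsTo_reflectSeq_BSPoset h
  have hinv := reflectSeq_involutive (n := p + 1) (p * m + b)
  exact ⟨⟨hmaps, hinv.injective.injOn, fun d hd => ⟨_, hmaps hd, hinv d⟩⟩,
    fun d _ e _ => (reflectSeq_le_reflectSeq_iff _ d e).symm, ⟨reflectBSPosetIso h⟩⟩
end

section
/- Let p ≥ 1 and 1 ≤ k ≤ p. Then the Boij-Söderberg poset Π_{(0,1,…,p),(k,k+1,…,p+k)} (on sequences of length p+1) is order-isomorphic to the Boij-Söderberg poset Π_{(0,1,…,k−1),(p+1,p+2,…,p+k)} (on sequences of length k); that is, there exists an order-preserving bijection between them whose inverse is also order-preserving. -/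
/-- Strictly increasing sequences `d : Fin n → ℤ` with `i ≤ d i ≤ m + i`. -/
def boxSequences (n m : ℕ) : Set (Fin n → ℤ) :=
  {d | StrictMono d ∧ ∀ i : Fin n, ((i : ℕ) : ℤ) ≤ d i ∧ d i ≤ (m : ℤ) + (i : ℕ)}

/-- Conjugation of the partition `i ↦ d i - i`, expressed on strictly increasing sequences. -/
def conjSequence {n : ℕ} (m : ℕ) (d : Fin n → ℤ) (j : Fin m) : ℤ :=
  ((Finset.univ.filter fun i : Fin n => (m : ℤ) - (j : ℕ) ≤ d i - (i : ℕ)).card : ℤ) + (j : ℕ)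

theorem StrictMono.monotone_sub_fin_val {n : ℕ} {d : Fin n → ℤ} (hd : StrictMono d) :
    Monotone fun i => d i - ((i : ℕ) : ℤ) := by
  have key : ∀ (t a : ℕ) (h : a + t < n), d ⟨a, by omega⟩ + t ≤ d ⟨a + t, h⟩ := by
    intro t a
    induction t with
    | zero => intro h; simp
    | succ t ih =>
      intro h
      have h₁ := ih (by omega)
      have h₂ : d ⟨a + t, by omega⟩ < d ⟨a + (t + 1), h⟩ := hd (by simp [Fin.lt_def])
      push_cast
      omega
  rintro ⟨a, ha⟩ ⟨b, hb⟩ hab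
  obtain ⟨t, rfl⟩ := Nat.exists_eq_add_of_le (show a ≤ b from hab)
  have := key t a hb
  push_cast
  omega

theorem IsUpperSet.mem_iff_le_card_fin {n : ℕ} {s : Finset (Fin n)}
    (hs : IsUpperSet (s : Set (Fin n))) (i : Fin n) : i ∈ s ↔ n - (i : ℕ) ≤ s.card := by
  constructor
  · intro hi
    rw [← Fin.card_Ici]
    exact Finset.card_le_card fun x hx => hs (Finset.mem_Ici.1 hx) hi
  · intro h
    by_contra hi
    have hsub : s ⊆ Finset.Ioi i := fun x hx =>
      Finset.mem_Ioi.2 (not_le.1 fun hxi => hi (hs hxi hx))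
    have := Finset.card_le_card hsub
    rw [Fin.card_Ioi] at this
    omega

theorem le_sub_iff_le_conjSequence_sub {n m : ℕ} {d : Fin n → ℤ} (hd : StrictMono d)
    (i : Fin n) (j : Fin m) :
    (m : ℤ) - (j : ℕ) ≤ d i - (i : ℕ) ↔ (n : ℤ) - (i : ℕ) ≤ conjSequence m d j - (j : ℕ) := by
  have hs : IsUpperSet ((Finset.univ.filter fun i : Fin n =>
      (m : ℤ) - (j : ℕ) ≤ d i - (i : ℕ) : Finset (Fin n)) : Set (Fin n)) := by
    intro a b hab ha
    have := hd.monotone_sub_fin_val hab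
    simp only [Finset.coe_filter, Finset.mem_univ, true_and, Set.mem_ofPred_eq] at ha ⊢
    exact ha.trans this
  have h := hs.mem_iff_le_card_fin i
  rw [Finset.mem_filter] at h
  simp only [Finset.mem_univ, true_and] at h
  rw [h, conjSequence]
  omega

theorem conjSequence_mem {n m : ℕ} (d : Fin n → ℤ) :
    conjSequence m d ∈ boxSequences m n := by
  refine ⟨fun a b hab => ?_, fun j => ?_⟩
  · have hab' : (a : ℕ) < b := hab
    have : (Finset.univ.filter fun i : Fin n => (m : ℤ) - (a : ℕ) ≤ d i - (i : ℕ)).card ≤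
        (Finset.univ.filter fun i : Fin n => (m : ℤ) - (b : ℕ) ≤ d i - (i : ℕ)).card :=
      Finset.card_le_card (Finset.monotone_filter_right _ fun i _ hi => by omega)
    unfold conjSequence
    omega
  · have := Finset.card_le_univ
      (Finset.univ.filter fun i : Fin n => (m : ℤ) - (j : ℕ) ≤ d i - (i : ℕ))
    rw [Fintype.card_fin] at this
    unfold conjSequence
    omega

theorem le_iff_of_mem_boxSequences {n m : ℕ} {d e : Fin n → ℤ} (hd : d ∈ boxSequences n m)
    (he : e ∈ boxSequences n m) :
    d ≤ e ↔ ∀ (i : Fin n) (j : Fin m),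
      (m : ℤ) - (j : ℕ) ≤ d i - (i : ℕ) → (m : ℤ) - (j : ℕ) ≤ e i - (i : ℕ) := by
  refine ⟨fun h i j hij => ?_, fun h i => ?_⟩
  · have : d i ≤ e i := h i
    omega
  · change d i ≤ e i
    have hdi := hd.2 i
    have hei := he.2 i
    by_cases h0 : d i = (i : ℕ)
    · omega
    · have := h i ⟨((m : ℤ) - (d i - (i : ℕ))).toNat, by omega⟩
      simp only [Int.toNat_of_nonneg (show (0 : ℤ) ≤ m - (d i - (i : ℕ)) by omega)] at this
      omega

theorem conjSequence_conjSequence {n m : ℕ} {d : Fin n → ℤ} (hd : d ∈ boxSequences n m) :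
    conjSequence n (conjSequence m d) = d := by
  have hc := conjSequence_mem (m := m) d
  have hcc := conjSequence_mem (m := n) (conjSequence m d)
  have key : ∀ (i : Fin n) (j : Fin m), (m : ℤ) - (j : ℕ) ≤ d i - (i : ℕ) ↔
      (m : ℤ) - (j : ℕ) ≤ conjSequence n (conjSequence m d) i - (i : ℕ) := fun i j =>
    (le_sub_iff_le_conjSequence_sub hd.1 i j).trans (le_sub_iff_le_conjSequence_sub hc.1 j i)
  exact le_antisymm ((le_iff_of_mem_boxSequences hcc hd).2 fun i j => (key i j).2)
    ((le_iff_of_mem_boxSequences hd hcc).2 fun i j => (key i j).1)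

/-- Conjugation of partitions as an order isomorphism between sets of strictly increasing
sequences. -/
def boxSequencesConj (n m : ℕ) : boxSequences n m ≃o boxSequences m n where
  toFun d := ⟨conjSequence m d.1, conjSequence_mem _⟩
  invFun e := ⟨conjSequence n e.1, conjSequence_mem _⟩
  left_inv d := Subtype.ext (conjSequence_conjSequence d.2)
  right_inv e := Subtype.ext (conjSequence_conjSequence e.2)
  map_rel_iff' {d e} := by
    change conjSequence m d.1 ≤ conjSequence m e.1 ↔ d.1 ≤ e.1
    rw [le_iff_of_mem_boxSequences (conjSequence_mem _) (conjSequence_mem _),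
      le_iff_of_mem_boxSequences d.2 e.2, forall_comm]
    simp only [le_sub_iff_le_conjSequence_sub d.2.1, le_sub_iff_le_conjSequence_sub e.2.1]

theorem stmt_5 (p k : ℕ) (hp : 1 ≤ p) (hk1 : 1 ≤ k) (hkp : k ≤ p) :
    Nonempty
      ((BSPoset p (fun i => (i : ℕ)) (fun i => (k : ℤ) + (i : ℕ))) ≃o
        (BSPoset (k - 1) (fun j => (j : ℕ)) (fun j => (p : ℤ) + 1 + (j : ℕ)))) := by
  obtain ⟨k, rfl⟩ := Nat.exists_eq_add_of_le' hk1
  exact ⟨boxSequencesConj (p + 1) (k + 1)⟩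
end

section
/- Let p, k ∈ ℕ with k ≥ 1, and for strictly increasing sequences d, e : {0,…,p} → {0,…,p+k} write comp(d) : {0,…,k−1} → {0,…,p+k} for the strictly increasing enumeration of the complement of the image of d in {0,…,p+k}. Then e_i ≤ d_i for all 0 ≤ i ≤ p if and only if comp(d)_j ≤ comp(e)_j for all 0 ≤ j ≤ k−1. In particular, taking complements of images gives an order-isomorphism from the order dual of Π_{(0,…,p),(k,…,p+k)} onto Π_{(0,…,k−1),(p+1,…,p+k)}. -/
/-- A pointwise inequality between monotone sequences is a reverse inequality between their
counting functions. -/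
theorem forall_le_iff_card_filter_le {n : ℕ} {d e : Fin n → ℤ} (hd : Monotone d)
    (he : Monotone e) :
    (∀ i, e i ≤ d i) ↔
      ∀ x, (Finset.univ.filter fun i => d i ≤ x).card ≤
        (Finset.univ.filter fun i => e i ≤ x).card := by
  constructor
  · intro h x
    refine Finset.card_le_card fun i hi => ?_
    simp only [Finset.mem_filter, Finset.mem_univ, true_and] at hi ⊢
    exact (h i).trans hi
  · intro h i
    by_contra! hlt
    have h1 : (Finset.Iic i).card ≤ (Finset.univ.filter fun j => d j ≤ d i).card := by
      refine Finset.card_le_card fun j hj => ?_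
      simpa using hd (Finset.mem_Iic.1 hj)
    have h2 : (Finset.univ.filter fun j => e j ≤ d i).card ≤ (Finset.Iio i).card := by
      refine Finset.card_le_card fun j hj => ?_
      simp only [Finset.mem_filter, Finset.mem_univ, true_and] at hj
      rw [Finset.mem_Iio]
      by_contra! hij
      exact absurd (he hij) (by omega)
    have h3 := h (d i)
    rw [Fin.card_Iic] at h1
    rw [Fin.card_Iio] at h2
    omega

/-- The counting functions of a sequence and of its complement in `{0,…,N}` add up to the counting
function of `{0,…,N}`. -/
theorem card_filter_add_card_filter_compl {m n : ℕ} {N : ℤ} {d : Fin m → ℤ} {c : Fin n → ℤ}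
    (hd : Function.Injective d) (hc : Function.Injective c) (hdN : ∀ i, 0 ≤ d i ∧ d i ≤ N)
    (hr : Set.range c = {x : ℤ | 0 ≤ x ∧ x ≤ N} \ Set.range d) (x : ℤ) :
    (Finset.univ.filter fun i => d i ≤ x).card + (Finset.univ.filter fun j => c j ≤ x).card =
      ((Finset.Icc 0 N).filter fun y => y ≤ x).card := by
  have hmem (y : ℤ) : (∃ j, c j = y) ↔ (0 ≤ y ∧ y ≤ N) ∧ ¬ ∃ i, d i = y :=
    Set.ext_iff.1 hr y
  rw [← Finset.card_image_of_injective _ hd, ← Finset.card_image_of_injective _ hc,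
    ← Finset.card_union_of_disjoint]
  · congr 1
    ext y
    simp only [Finset.mem_union, Finset.mem_image, Finset.mem_filter, Finset.mem_univ, true_and,
      Finset.mem_Icc]
    constructor
    · rintro (⟨i, hi, rfl⟩ | ⟨j, hj, rfl⟩)
      · exact ⟨hdN i, hi⟩
      · exact ⟨((hmem _).1 ⟨j, rfl⟩).1, hj⟩
    · rintro ⟨hy, hyx⟩
      by_cases h : ∃ i, d i = y
      · obtain ⟨i, rfl⟩ := h
        exact Or.inl ⟨i, hyx, rfl⟩
      · obtain ⟨j, rfl⟩ := (hmem y).2 ⟨hy, h⟩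
        exact Or.inr ⟨j, hyx, rfl⟩
  · rw [Finset.disjoint_left]
    simp only [Finset.mem_image, Finset.mem_filter, Finset.mem_univ, true_and]
    rintro _ ⟨i, -, rfl⟩ ⟨j, -, hj⟩
    exact ((hmem _).1 ⟨j, hj⟩).2 ⟨i, rfl⟩

/-- Taking complements in `{0,…,N}` reverses the componentwise order. -/
theorem forall_le_iff_forall_compl_le {m n : ℕ} {N : ℤ} {d e : Fin m → ℤ} {c c' : Fin n → ℤ}
    (hd : StrictMono d) (he : StrictMono e) (hdN : ∀ i, 0 ≤ d i ∧ d i ≤ N)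
    (heN : ∀ i, 0 ≤ e i ∧ e i ≤ N) (hc : StrictMono c) (hc' : StrictMono c')
    (hr : Set.range c = {x : ℤ | 0 ≤ x ∧ x ≤ N} \ Set.range d)
    (hr' : Set.range c' = {x : ℤ | 0 ≤ x ∧ x ≤ N} \ Set.range e) :
    (∀ i, e i ≤ d i) ↔ ∀ j, c j ≤ c' j := by
  rw [forall_le_iff_card_filter_le hd.monotone he.monotone,
    forall_le_iff_card_filter_le hc'.monotone hc.monotone]
  refine forall_congr' fun x => ?_
  have h1 := card_filter_add_card_filter_compl hd.injective hc.injective hdN hr x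
  have h2 := card_filter_add_card_filter_compl he.injective hc'.injective heN hr' x
  omega

/-- An injective sequence of length `m` in `{0,…,m+n-1}` has a complementary strictly increasing
sequence of length `n`. -/
theorem exists_strictMono_range_eq_compl {m n : ℕ} {N : ℤ} (hN : N + 1 = m + n) {d : Fin m → ℤ}
    (hd : Function.Injective d) (hdN : ∀ i, 0 ≤ d i ∧ d i ≤ N) :
    ∃ c : Fin n → ℤ, StrictMono c ∧
      Set.range c = {x : ℤ | 0 ≤ x ∧ x ≤ N} \ Set.range d := by
  have hcard : (Finset.Icc 0 N \ Finset.univ.image d).card = n := by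
    rw [Finset.card_sdiff_of_subset, Finset.card_image_of_injective _ hd, Finset.card_univ,
      Fintype.card_fin, Int.card_Icc]
    · omega
    · intro y hy
      obtain ⟨i, -, rfl⟩ := Finset.mem_image.1 hy
      exact Finset.mem_Icc.2 (hdN i)
  refine ⟨_, (Finset.orderEmbOfFin _ hcard).strictMono, ?_⟩
  rw [Finset.range_orderEmbOfFin]
  ext y
  simp

/-- A strictly increasing integer sequence grows at least as fast as its index. -/
theorem StrictMono.sub_le_sub_fin {n : ℕ} {d : Fin n → ℤ} (hd : StrictMono d) {i j : Fin n}
    (hij : i ≤ j) : ((j : ℕ) : ℤ) - (i : ℕ) ≤ d j - d i := by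
  have h : ((Finset.Icc i j).image d).card ≤ (Finset.Icc (d i) (d j)).card := by
    refine Finset.card_le_card fun y hy => ?_
    obtain ⟨l, hl, rfl⟩ := Finset.mem_image.1 hy
    rw [Finset.mem_Icc] at hl ⊢
    exact ⟨hd.monotone hl.1, hd.monotone hl.2⟩
  rw [Finset.card_image_of_injective _ hd.injective, Fin.card_Icc, Int.card_Icc] at h
  have := hd.monotone hij
  have : (i : ℕ) ≤ j := hij
  omega

/-- Membership in `Π_{(0,…,p),(K,…,p+K)}` only constrains the range of the sequence. -/
theorem mem_BSPoset_iff {p : ℕ} {K : ℤ} {d : Fin (p + 1) → ℤ} :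
    d ∈ BSPoset p (fun i => (i : ℕ)) (fun i => K + (i : ℕ)) ↔
      StrictMono d ∧ ∀ i, 0 ≤ d i ∧ d i ≤ p + K := by
  refine and_congr_right fun hd => ⟨fun h i => ?_, fun h i => ?_⟩
  · have h1 := h i
    have := i.is_le
    dsimp only at h1
    omega
  · have h1 := hd.sub_le_sub_fin (Fin.zero_le i)
    have h2 := hd.sub_le_sub_fin (Fin.le_last i)
    have h3 := h 0
    have h4 := h (Fin.last p)
    simp only [Fin.val_zero, Fin.val_last] at h1 h2
    dsimp only
    omega


theorem stmt_6 (p k : ℕ) (hk : 1 ≤ k) :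
    -- the complementation criterion for the componentwise order:
    ((∀ (d e : Fin (p+1) → ℤ), StrictMono d → StrictMono e →
        (∀ i, 0 ≤ d i ∧ d i ≤ (p : ℤ) + k) → (∀ i, 0 ≤ e i ∧ e i ≤ (p : ℤ) + k) →
      ∀ (c c' : Fin k → ℤ), StrictMono c → StrictMono c' →
        Set.range c = {x : ℤ | 0 ≤ x ∧ x ≤ (p : ℤ) + k} \ Set.range d →
        Set.range c' = {x : ℤ | 0 ≤ x ∧ x ≤ (p : ℤ) + k} \ Set.range e →
        ((∀ i, e i ≤ d i) ↔ ∀ j, c j ≤ c' j)) ∧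
    -- complementation is an order isomorphism from the dual of
    -- `Π_{(0,…,p),(k,…,p+k)}` onto `Π_{(0,…,k-1),(p+1,…,p+k)}`:
      ∃ F : (BSPoset p (fun i => (i : ℕ)) (fun i => (k : ℤ) + (i : ℕ)))ᵒᵈ ≃o
              BSPoset (k - 1) (fun j => (j : ℕ)) (fun j => (p : ℤ) + 1 + (j : ℕ)),
        ∀ d, Set.range (F d).1 =
          {x : ℤ | 0 ≤ x ∧ x ≤ (p : ℤ) + k} \ Set.range (OrderDual.ofDual d).1) := by
  refine ⟨fun d e hd he hdN heN c c' hc hc' hr hr' =>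
    forall_le_iff_forall_compl_le hd he hdN heN hc hc' hr hr', ?_⟩
  obtain ⟨k, rfl⟩ : ∃ l, k = l + 1 := ⟨k - 1, by omega⟩
  have hP (d : BSPoset p (fun i => (i : ℕ)) (fun i => ((k + 1 : ℕ) : ℤ) + (i : ℕ))) :=
    mem_BSPoset_iff.1 d.2
  have hQ (c : BSPoset k (fun j => (j : ℕ)) (fun j => (p : ℤ) + 1 + (j : ℕ))) :
      StrictMono c.1 ∧ ∀ j, 0 ≤ c.1 j ∧ c.1 j ≤ p + ((k + 1 : ℕ) : ℤ) := by
    have h := mem_BSPoset_iff.1 c.2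
    rwa [show (k : ℤ) + (p + 1) = p + ((k + 1 : ℕ) : ℤ) by push_cast; ring] at h
  have hfun (d : BSPoset p (fun i => (i : ℕ)) (fun i => ((k + 1 : ℕ) : ℤ) + (i : ℕ))) :
      ∃ c : BSPoset k (fun j => (j : ℕ)) (fun j => (p : ℤ) + 1 + (j : ℕ)),
        Set.range c.1 = {x : ℤ | 0 ≤ x ∧ x ≤ (p : ℤ) + ((k + 1 : ℕ) : ℤ)} \ Set.range d.1 := by
    obtain ⟨c, hc, hr⟩ := exists_strictMono_range_eq_compl (n := k + 1)
      (by push_cast; ring) (hP d).1.injective (hP d).2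
    refine ⟨⟨c, mem_BSPoset_iff.2 ⟨hc, fun j => ?_⟩⟩, hr⟩
    have h := (hr.subset ⟨j, rfl⟩).1
    simp only [Set.mem_ofPred_eq] at h
    omega
  have hinv (c : BSPoset k (fun j => (j : ℕ)) (fun j => (p : ℤ) + 1 + (j : ℕ))) :
      ∃ d : BSPoset p (fun i => (i : ℕ)) (fun i => ((k + 1 : ℕ) : ℤ) + (i : ℕ)),
        Set.range d.1 = {x : ℤ | 0 ≤ x ∧ x ≤ (p : ℤ) + ((k + 1 : ℕ) : ℤ)} \ Set.range c.1 := by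
    obtain ⟨d, hd, hr⟩ := exists_strictMono_range_eq_compl (n := p + 1)
      (by push_cast; ring) (hQ c).1.injective (hQ c).2
    exact ⟨⟨d, mem_BSPoset_iff.2 ⟨hd, fun i => (hr.subset ⟨i, rfl⟩).1⟩⟩, hr⟩
  choose f hf using hfun
  choose g hg using hinv
  refine ⟨{ toFun := fun d => f (OrderDual.ofDual d)
            invFun := fun c => OrderDual.toDual (g c)
            left_inv := fun d => ?_
            right_inv := fun c => ?_
            map_rel_iff' := fun {d e} => ?_ }, fun d => hf (OrderDual.ofDual d)⟩
  · refine congrArg OrderDual.toDual (Subtype.ext (((hP _).1.range_inj (hP _).1).1 ?_))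
    rw [hg, hf]
    refine Set.sdiff_sdiff_cancel_left ?_
    rintro _ ⟨i, rfl⟩
    exact (hP _).2 i
  · refine Subtype.ext (((hQ _).1.range_inj (hQ _).1).1 ?_)
    rw [hf, OrderDual.ofDual_toDual, hg, Set.sdiff_sdiff_cancel_left]
    rintro _ ⟨j, rfl⟩
    exact (hQ _).2 j
  · exact (forall_le_iff_forall_compl_le (hP _).1 (hP _).1 (hP _).2 (hP _).2 (hQ _).1 (hQ _).1
      (hf (OrderDual.ofDual d)) (hf (OrderDual.ofDual e))).symm
end

section
/- Let p, k ∈ ℕ with k ≥ 1, let d̲ = (0,1,…,p) and d̄ = (k,k+1,…,p+k), and let N = (p+1)·k. Let n denote the number of maximal chains of Π_{d̲,d̄}, i.e., the number of functions c : {0,1,…,N} → Π_{d̲,d̄} with c(0) = d̲, c(N) = d̄, and c(j+1) covering c(j) for all 0 ≤ j < N. Then n = ((p+1)k)! · ∏_{i=0}^{p} i!/(k+i)!; equivalently, n · ∏_{i=0}^{p} (k+i)! = ((p+1)k)! · ∏_{i=0}^{p} i!. -/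
/-- The set of maximal chains of length `N` in `Π_{d̲,d̄}`: functions
`c : {0,…,N} → Π_{d̲,d̄}` starting at `d̲`, ending at `d̄`, each step a covering. -/
def BSMaxChains (p : ℕ) (dl du : Fin (p+1) → ℤ) (N : ℕ) :
    Set (Fin (N+1) → BSPoset p dl du) :=
  {c | (c 0 : Fin (p+1) → ℤ) = dl ∧ (c (Fin.last N) : Fin (p+1) → ℤ) = du ∧
    ∀ j : Fin N, c j.castSucc ⋖ c j.succ}

open Finset Matrix

/-- The `r`-chains with `n` steps from `a` to `b`. -/
def relChains {T : Type*} (r : T → T → Prop) (a : T) (n : ℕ) (b : T) : Set (Fin (n + 1) → T) :=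
  {c | c 0 = a ∧ c (Fin.last n) = b ∧ ∀ j : Fin n, r (c j.castSucc) (c j.succ)}

theorem snoc_mem_relChains {T : Type*} {r : T → T → Prop} {a x b : T} {n : ℕ}
    {c : Fin (n + 1) → T} (hc : c ∈ relChains r a n x) (hx : r x b) :
    (Fin.snoc c b : Fin (n + 2) → T) ∈ relChains r a (n + 1) b := by
  obtain ⟨h0, rfl, h⟩ := hc
  refine ⟨?_, by simp, fun j => ?_⟩
  · rw [← Fin.castSucc_zero, Fin.snoc_castSucc, h0]
  · induction j using Fin.lastCases with
    | last => simpa using hx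
    | cast j => rw [Fin.succ_castSucc, Fin.snoc_castSucc, Fin.snoc_castSucc]; exact h j

theorem ncard_relChains_zero {T : Type*} (r : T → T → Prop) (a : T) :
    (relChains r a 0 a).ncard = 1 := by
  rw [Set.ncard_eq_one]
  refine ⟨fun _ => a, Set.ext fun c => ⟨fun h => ?_, ?_⟩⟩
  · funext i
    rw [Fin.fin_one_eq_zero i]
    exact h.1
  · rintro rfl
    exact ⟨rfl, rfl, fun j => j.elim0⟩

open Classical in
theorem ncard_relChains_succ {T : Type*} [Fintype T] (r : T → T → Prop) (a b : T) (n : ℕ) :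
    (relChains r a (n + 1) b).ncard = ∑ x with r x b, (relChains r a n x).ncard := by
  let f : (Σ x : {x // r x b}, relChains r a n x.1) → relChains r a (n + 1) b :=
    fun s => ⟨Fin.snoc s.2.1 b, snoc_mem_relChains s.2.2 s.1.2⟩
  have hf : f.Bijective := by
    constructor
    · rintro ⟨⟨x, hx⟩, ⟨c, hc⟩⟩ ⟨⟨x', hx'⟩, ⟨c', hc'⟩⟩ heq
      obtain rfl : c = c' := by
        have := congrArg (fun s => Fin.init s.1) heq
        simpa [f] using this
      obtain rfl : c (Fin.last n) = x := hc.2.1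
      obtain rfl : c (Fin.last n) = x' := hc'.2.1
      rfl
    · rintro ⟨c, h0, rfl, h⟩
      refine ⟨⟨⟨c (Fin.last n).castSucc, h (Fin.last n)⟩, ⟨Fin.init c, h0, rfl, fun j => ?_⟩⟩, ?_⟩
      · exact h j.castSucc
      · exact Subtype.ext (Fin.snoc_init_self c)
  rw [← Nat.card_coe_set_eq, ← Nat.card_congr (Equiv.ofBijective f hf), Nat.card_sigma]
  simp only [Nat.card_coe_set_eq]
  exact (Finset.sum_subtype _ (by simp) fun x => (relChains r a n x).ncard).symm

theorem Matrix.sum_det_mul_sub {n R : Type*} [Fintype n] [DecidableEq n] [CommRing R]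
    (A : Matrix n n R) (x c : n → R) :
    ∑ i, (A.updateRow i fun j => A i j * (x i - c j)).det = (∑ i, x i - ∑ j, c j) * A.det := by
  simp only [← det_transpose A, ← det_transpose (updateRow _ _ _), det_apply, Finset.mul_sum]
  rw [Finset.sum_comm]
  refine Finset.sum_congr rfl fun σ _ => ?_
  have key (i : n) : ∏ k, (A.updateRow i fun j => A i j * (x i - c j))ᵀ (σ k) k =
      (x i - c (σ i)) * ∏ k, Aᵀ (σ k) k := by
    rw [← Finset.mul_prod_erase _ _ (mem_univ i), ← Finset.mul_prod_erase _ _ (mem_univ i)]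
    have : ∏ k ∈ univ.erase i, (A.updateRow i fun j => A i j * (x i - c j))ᵀ (σ k) k =
        ∏ k ∈ univ.erase i, Aᵀ (σ k) k :=
      Finset.prod_congr rfl fun k hk => by
        simp [updateRow_ne (ne_of_mem_erase hk)]
    rw [this]
    simp only [transpose_apply, updateRow_self]
    ring
  simp only [key, ← Finset.smul_sum, ← Finset.sum_mul, Finset.sum_sub_distrib,
    Equiv.sum_comp σ c, mul_smul_comm]

theorem Matrix.det_vandermonde_eq_det_descPochhammer {R : Type*} [CommRing R] [IsDomain R]
    {m : ℕ} (v : Fin m → R) :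
    (vandermonde v).det = (of fun i j : Fin m => (descPochhammer R j).eval (v i)).det :=
  det_eval_matrixOfPolynomials_eq_det_vandermonde v (fun j => descPochhammer R j)
    (fun _ => descPochhammer_natDegree R _) (fun _ => monic_descPochhammer R _)

theorem Matrix.sum_mul_det_vandermonde_sub_single {R : Type*} [CommRing R] [IsDomain R]
    {m : ℕ} (v : Fin m → R) :
    ∑ i, v i * (vandermonde (v - Pi.single i 1)).det =
      (∑ i, v i - ∑ j : Fin m, (j : R)) * (vandermonde v).det := by
  rw [det_vandermonde_eq_det_descPochhammer v,
    ← sum_det_mul_sub _ v fun j : Fin m => (j : R)]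
  refine Finset.sum_congr rfl fun i _ => ?_
  rw [det_vandermonde_eq_det_descPochhammer]
  set A : Matrix (Fin m) (Fin m) R := of fun i j : Fin m => (descPochhammer R j).eval (v i)
  have : (of fun i' j : Fin m => (descPochhammer R j).eval ((v - Pi.single i 1 : Fin m → R) i')) =
      A.updateRow i fun j => (descPochhammer R j).eval (v i - 1) := by
    ext i' j
    rcases eq_or_ne i' i with rfl | h
    · simp
    · simp [A, h]
  rw [this, ← det_updateRow_smul]
  congr 2
  funext j
  have h := congrArg (Polynomial.eval (v i)) (descPochhammer_succ_left R j)
  rw [descPochhammer_succ_eval] at h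
  simpa [A, eq_comm] using h

section BSPoset

variable {p : ℕ} {dl du : Fin (p + 1) → ℤ}

theorem finite_BSPoset (p : ℕ) (dl du : Fin (p + 1) → ℤ) : (BSPoset p dl du).Finite :=
  (Set.finite_Icc dl du).subset fun _ hd => ⟨fun i => (hd.2 i).1, fun i => (hd.2 i).2⟩

noncomputable instance : Fintype (BSPoset p dl du) := (finite_BSPoset p dl du).fintype

theorem BSPoset.exists_add_single_le {x y : BSPoset p dl du} (h : x < y) :
    ∃ i, ∃ hi : x.1 + Pi.single i 1 ∈ BSPoset p dl du,
      (⟨x.1 + Pi.single i 1, hi⟩ : BSPoset p dl du) ≤ y := by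
  have hle : ∀ i, x.1 i ≤ y.1 i := h.le
  have hne : (univ.filter fun i => x.1 i < y.1 i).Nonempty := by
    obtain ⟨-, i, hi⟩ := Pi.lt_def.1 (show x.1 < y.1 from h)
    exact ⟨i, by simpa using hi⟩
  obtain ⟨i, hi, hmax⟩ := Finset.exists_max_image _ id hne
  simp only [mem_filter, mem_univ, true_and, id] at hi hmax
  have hxy : x.1 + Pi.single i 1 ≤ y.1 := fun j => by
    rcases eq_or_ne j i with rfl | hj
    · simpa using hi
    · simpa [hj] using hle j
  refine ⟨i, ⟨fun a b hab => ?_, fun j => ⟨?_, (hxy j).trans (y.2.2 j).2⟩⟩, hxy⟩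
  · have hx := x.2.1 hab
    rcases eq_or_ne a i with rfl | ha
    · have hb : ¬ x.1 b < y.1 b := fun hb => absurd (hmax b hb) (not_le.2 hab)
      have hy := y.2.1 hab
      have := hle b
      simp only [Pi.add_apply, Pi.single_eq_same, Pi.single_eq_of_ne hab.ne', add_zero]
      omega
    · rcases eq_or_ne b i with rfl | hb <;> simp [*]
      omega
  · have := (x.2.2 j).1
    rcases eq_or_ne j i with rfl | hj <;> simp [*]
    omega

theorem BSPoset.covBy_iff {x y : BSPoset p dl du} :
    x ⋖ y ↔ ∃ i, x.1 = y.1 - Pi.single i 1 := by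
  constructor
  · intro h
    obtain ⟨i, hi, hle⟩ := exists_add_single_le h.lt
    have hlt : x < ⟨x.1 + Pi.single i 1, hi⟩ := by
      show x.1 < x.1 + Pi.single i 1
      simp
    exact ⟨i, eq_sub_of_add_eq (congrArg Subtype.val (hle.eq_of_not_lt (h.2 hlt)))⟩
  · rintro ⟨i, hi⟩
    refine ⟨?_, fun z hxz hzy => ?_⟩
    · show x.1 < y.1
      simp [hi]
    · have hxz' : ∀ j, x.1 j ≤ z.1 j := hxz.le
      have hzy' : ∀ j, z.1 j ≤ y.1 j := hzy.le
      have hj (j) (hj : j ≠ i) : x.1 j = y.1 j := by simp [hi, hj]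
      have hii : x.1 i = y.1 i - 1 := by simp [hi]
      rcases eq_or_lt_of_le (hxz' i) with h | h
      · refine hxz.ne (Subtype.ext (funext fun j => ?_))
        rcases eq_or_ne j i with rfl | hji
        · exact h
        · have := hj j hji; have := hxz' j; have := hzy' j; omega
      · refine hzy.ne (Subtype.ext (funext fun j => ?_))
        rcases eq_or_ne j i with rfl | hji
        · have := hzy' j; omega
        · have := hj j hji; have := hxz' j; have := hzy' j; omega

open Classical in
theorem BSPoset.sum_covBy {M : Type*} [AddCommMonoid M] (y : BSPoset p dl du)
    (g : BSPoset p dl du → M) (f : Fin (p + 1) → M)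
    (hg : ∀ (x : BSPoset p dl du) i, x.1 = y.1 - Pi.single i 1 → g x = f i)
    (hf : ∀ i, y.1 - Pi.single i 1 ∉ BSPoset p dl du → f i = 0) :
    ∑ x with x ⋖ y, g x = ∑ i, f i := by
  rw [← Finset.sum_filter_of_ne (p := fun i => y.1 - Pi.single i 1 ∈ BSPoset p dl du)
    fun i _ h => not_not.1 (mt (hf i) h)]
  symm
  refine Finset.sum_bij (fun i hi => ⟨y.1 - Pi.single i 1, (mem_filter.1 hi).2⟩) ?_ ?_ ?_ ?_
  · exact fun i hi => mem_filter.2 ⟨mem_univ _, covBy_iff.2 ⟨i, rfl⟩⟩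
  · intro i _ j _ h
    by_contra hij
    have := congrFun (congrArg Subtype.val h) i
    simp [Pi.single_eq_of_ne hij] at this
  · intro x hx
    obtain ⟨i, hi⟩ := covBy_iff.1 (mem_filter.1 hx).2
    exact ⟨i, mem_filter.2 ⟨mem_univ _, hi ▸ x.2⟩, Subtype.ext hi.symm⟩
  · exact fun i _ => (hg _ i rfl).symm

end BSPoset

theorem mul_det_vandermonde_eq_zero_of_notMem_BSPoset {p : ℕ} {du y : Fin (p + 1) → ℤ}
    (hy : y ∈ BSPoset p (fun i => (i : ℕ)) du) {i : Fin (p + 1)}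
    (hi : y - Pi.single i 1 ∉ BSPoset p (fun i => (i : ℕ)) du) :
    y i * (vandermonde (y - Pi.single i 1)).det = 0 := by
  by_contra hne
  obtain ⟨hyi, hdet⟩ := mul_ne_zero_iff.1 hne
  have hinj := det_vandermonde_ne_zero_iff.1 hdet
  have hmono : StrictMono (y - Pi.single i 1) := by
    refine Monotone.strictMono_of_injective (fun a b hab => ?_) hinj
    rcases hab.eq_or_lt with rfl | hab
    · rfl
    have := hy.1 hab
    rcases eq_or_ne a i with rfl | ha
    · simp [hab.ne']; omega
    · rcases eq_or_ne b i with rfl | hb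
      · simp [ha]; omega
      · simp [ha, hb]; omega
  refine hi ⟨hmono, fun j => ⟨?_, ?_⟩⟩
  · have hj := (hy.2 j).1
    rcases eq_or_ne j i with rfl | hji
    · rcases Fin.eq_zero_or_eq_succ j with rfl | ⟨k, rfl⟩
      · simp at hj ⊢; omega
      · have h1 := (hy.2 k.castSucc).1
        have h2 := hmono (Fin.castSucc_lt_succ (i := k))
        simp [Fin.castSucc_lt_succ.ne] at h1 h2 ⊢; omega
    · simpa [hji] using hj
  · have := (hy.2 j).2
    rcases eq_or_ne j i with rfl | hji <;> simp [*]; omega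

theorem prod_factorial_toNat_eq_mul {p : ℕ} {y : Fin (p + 1) → ℤ} {i : Fin (p + 1)}
    (hi : 1 ≤ y i) :
    (∏ j, ((y j).toNat.factorial : ℤ)) =
      y i * ∏ j, (((y - Pi.single i 1 : Fin (p + 1) → ℤ) j).toNat.factorial : ℤ) := by
  rw [← Finset.mul_prod_erase _ _ (mem_univ i), ← Finset.mul_prod_erase _ _ (mem_univ i),
    ← mul_assoc]
  congr 1
  · obtain ⟨m, hm⟩ := Int.eq_ofNat_of_zero_le (sub_nonneg.2 hi)
    obtain hm : y i = (m + 1 : ℕ) := by push_cast; omega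
    simp only [Pi.sub_apply, Pi.single_eq_same, hm, Int.toNat_natCast, Nat.factorial_succ]
    simp
  · exact Finset.prod_congr rfl fun j hj => by simp [ne_of_mem_erase hj]

theorem BSPoset.ncard_relChains_mul_prod_factorial {p : ℕ} {du : Fin (p + 1) → ℤ}
    (a : BSPoset p (fun i => (i : ℕ)) du) (ha : a.1 = fun i : Fin (p + 1) => ((i : ℕ) : ℤ)) (n : ℕ)
    (y : BSPoset p (fun i => (i : ℕ)) du)
    (hy : ∑ i, y.1 i = n + ∑ i : Fin (p + 1), ((i : ℕ) : ℤ)) :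
    ((relChains (· ⋖ ·) a n y).ncard : ℤ) * ∏ i, ((y.1 i).toNat.factorial : ℤ) =
      n.factorial * (vandermonde y.1).det := by
  induction n generalizing y with
  | zero =>
    have heq := (Finset.sum_eq_sum_iff_of_le fun i _ => (y.2.2 i).1).1 (by simpa using hy.symm)
    obtain rfl : a = y := Subtype.ext (ha.trans (funext fun i => heq i (mem_univ i)))
    rw [ncard_relChains_zero, ha, det_vandermonde_id_eq_superFactorial (R := ℤ),
      ← Nat.prod_range_succ_factorial, ← Fin.prod_univ_eq_prod_range]
    simp
  | succ n ih =>
    classical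
    rw [ncard_relChains_succ, Nat.cast_sum, Finset.sum_mul,
      sum_covBy y _ fun i => n.factorial * (y.1 i * (vandermonde (y.1 - Pi.single i 1)).det)]
    · rw [← Finset.mul_sum, sum_mul_det_vandermonde_sub_single, hy, Nat.factorial_succ]
      push_cast
      ring
    · intro x i hx
      have hi : 1 ≤ y.1 i := by
        have h1 := (x.2.2 i).1
        simp [hx] at h1
        omega
      have hsum : ∑ j, x.1 j = n + ∑ j : Fin (p + 1), ((j : ℕ) : ℤ) := by
        simp only [hx, Pi.sub_apply, Finset.sum_sub_distrib, hy]
        simp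
        ring
      rw [prod_factorial_toNat_eq_mul hi, ← hx, mul_left_comm, ih x hsum]
      ring
    · intro i hi
      rw [mul_det_vandermonde_eq_zero_of_notMem_BSPoset y.2 hi, mul_zero]

theorem stmt_8 (p k : ℕ) (hk : 1 ≤ k) :
    (BSMaxChains p (fun i => (i : ℕ)) (fun i => (k : ℤ) + (i : ℕ)) ((p+1)*k)).ncard *
        ∏ i ∈ Finset.range (p+1), Nat.factorial (k + i) =
      Nat.factorial ((p+1)*k) * ∏ i ∈ Finset.range (p+1), Nat.factorial i := by
  let a : BSPoset p (fun i => (i : ℕ)) (fun i => (k : ℤ) + (i : ℕ)) :=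
    ⟨fun i => (i : ℕ), fun i j h => by simpa using h, fun i => by simp⟩
  let b : BSPoset p (fun i => (i : ℕ)) (fun i => (k : ℤ) + (i : ℕ)) :=
    ⟨fun i => (k : ℤ) + (i : ℕ), fun i j h => by simpa using h, fun i => by simp⟩
  have hchains : BSMaxChains p (fun i => (i : ℕ)) (fun i => (k : ℤ) + (i : ℕ)) ((p+1)*k) =
      relChains (· ⋖ ·) a ((p+1)*k) b := by
    ext c
    simp only [BSMaxChains, relChains, Set.mem_ofPred_eq, Subtype.ext_iff, a, b]
  have h := BSPoset.ncard_relChains_mul_prod_factorial a rfl ((p+1)*k) b (by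
    simp [b, Finset.sum_add_distrib])
  have hdet : (vandermonde b.1).det = (p.superFactorial : ℤ) := by
    rw [← det_vandermonde_id_eq_superFactorial, ← det_vandermonde_add (fun i : Fin (p + 1) => ((i : ℕ) : ℤ)) (k : ℤ)]
    simp only [b, add_comm (k : ℤ)]
  rw [hdet] at h
  rw [hchains, Nat.prod_range_succ_factorial, ← Fin.prod_univ_eq_prod_range]
  have htoNat (i : Fin (p + 1)) : (b.1 i).toNat = k + i := by simp only [b]; omega
  simp only [htoNat] at h
  exact_mod_cast h
end

section
/- Let N = Σ_{i=0}^{p} (d̄_i − d̲_i) and let n denote the number of maximal chains of Π_{d̲,d̄}, i.e., the number of functions c : {0,…,N} → Π_{d̲,d̄} with c(0) = d̲, c(N) = d̄, and c(j+1) covering c(j) for all 0 ≤ j < N. Set k₂ = d̄_p − d̲_0 − p (which is a nonnegative integer). Then n · ∏_{i=0}^{p} (k₂+i)! ≤ ((p+1)k₂)! · ∏_{i=0}^{p} i!, i.e., n ≤ f(p,k₂) where f(p,k) = ((p+1)k)! · ∏_{i=0}^{p} i!/(k+i)!. Moreover, if k₁ = d̄_0 − d̲_p + p ≥ 0, then ((p+1)k₁)!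 · ∏_{i=0}^{p} i! ≤ n · ∏_{i=0}^{p} (k₁+i)!, i.e., f(p,k₁) ≤ n. -/
open Finset in
theorem Matrix.sum_det_updateRow {n R : Type*} [Fintype n] [DecidableEq n] [CommRing R]
    (A W : Matrix n n R) : ∑ i, (A.updateRow i (W i)).det = (W * A.adjugate).trace := by
  refine sum_congr rfl fun i _ => ?_
  rw [← Matrix.cramer_transpose_apply, Matrix.cramer_eq_adjugate_mulVec,
    ← Matrix.adjugate_transpose, Matrix.mulVec_transpose]
  rfl

theorem Matrix.det_descPochhammer_eq_det_vandermonde {n : ℕ} (x : Fin n → ℤ) :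
    (Matrix.of fun i j : Fin n => (descPochhammer ℤ j).eval (x i)).det =
      (Matrix.vandermonde x).det :=
  (Matrix.det_eval_matrixOfPolynomials_eq_det_vandermonde x (fun j => descPochhammer ℤ j)
    (fun j => descPochhammer_natDegree ℤ j) (fun j => monic_descPochhammer ℤ j)).symm

/-- Lowering one coordinate of a Vandermonde determinant at a time. -/
theorem Matrix.sum_mul_det_vandermonde_update {n : ℕ} (x : Fin n → ℤ) :
    ∑ i, x i * (Matrix.vandermonde (Function.update x i (x i - 1))).det =
      (∑ i, (x i - (i : ℤ))) * (Matrix.vandermonde x).det := by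
  set A : Matrix (Fin n) (Fin n) ℤ :=
    Matrix.of fun i j : Fin n => (descPochhammer ℤ j).eval (x i) with hA
  have key (i : Fin n) : x i * (Matrix.vandermonde (Function.update x i (x i - 1))).det =
      (A.updateRow i ((Matrix.diagonal x * A -
        A * Matrix.diagonal fun j : Fin n => ((j : ℕ) : ℤ)) i)).det := by
    rw [← Matrix.det_descPochhammer_eq_det_vandermonde, ← smul_eq_mul]
    have h : (Matrix.of fun k j : Fin n =>
        (descPochhammer ℤ j).eval (Function.update x i (x i - 1) k)) =
        A.updateRow i fun j => (descPochhammer ℤ j).eval (x i - 1) := by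
      ext k j
      by_cases hk : k = i
      · subst hk; simp
      · simp [hk, hA]
    rw [h, smul_eq_mul, ← Matrix.det_updateRow_smul]
    congr 2
    ext j
    have h1 := congrArg (Polynomial.eval (x i)) (descPochhammer_succ_left ℤ j)
    have h2 := descPochhammer_succ_eval (j : ℕ) (x i)
    simp only [Polynomial.eval_mul, Polynomial.eval_X, Polynomial.eval_comp, Polynomial.eval_sub,
      Polynomial.eval_one] at h1
    simp only [Pi.smul_apply, smul_eq_mul, Matrix.sub_apply, Matrix.diagonal_mul,
      Matrix.mul_diagonal, hA, Matrix.of_apply]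
    rw [← h1, h2]
    ring
  rw [Finset.sum_congr rfl fun i _ => key i, Matrix.sum_det_updateRow, sub_mul, Matrix.trace_sub,
    Matrix.mul_assoc, Matrix.mul_adjugate, Matrix.mul_assoc, Matrix.trace_mul_comm A,
    Matrix.mul_assoc, Matrix.adjugate_mul, ← Matrix.det_descPochhammer_eq_det_vandermonde]
  rw [Matrix.mul_smul, Matrix.mul_smul, Matrix.mul_one, Matrix.mul_one, Matrix.trace_smul,
    Matrix.trace_smul, Matrix.trace_diagonal, Matrix.trace_diagonal, ← hA, smul_eq_mul, smul_eq_mul,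
    Finset.sum_sub_distrib]
  ring

/-- The number of saturated chains of length `N` from `a` to `b` in the poset of strictly
increasing integer sequences. -/
noncomputable def strictChainCount {n : ℕ} (a : Fin n → ℤ) : ℕ → (Fin n → ℤ) → ℕ
  | 0, b => open Classical in if a = b ∧ StrictMono b then 1 else 0
  | N + 1, b => open Classical in
    if StrictMono b then ∑ i, strictChainCount a N (Function.update b i (b i - 1)) else 0

section StrictChainCount

variable {n : ℕ}

theorem strictChainCount_eq_zero_of_not_strictMono (a : Fin n → ℤ) (N : ℕ) {b : Fin n → ℤ}
    (hb : ¬ StrictMono b) : strictChainCount a N b = 0 := by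
  cases N <;> simp [strictChainCount, hb]

theorem strictChainCount_eq_zero_of_not_le (a : Fin n → ℤ) (N : ℕ) {b : Fin n → ℤ}
    (hab : ¬ a ≤ b) : strictChainCount a N b = 0 := by
  induction N generalizing b with
  | zero =>
    have : a ≠ b := fun h => hab h.le
    simp [strictChainCount, this]
  | succ N ih =>
    simp only [strictChainCount, ite_eq_right_iff, Finset.sum_eq_zero_iff]
    refine fun _ i _ => ih fun h => hab (h.trans ?_)
    rw [update_le_self_iff]
    omega

theorem strictChainCount_mul_le (a b c : Fin n → ℤ) (M N : ℕ) :
    strictChainCount a M b * strictChainCount b N c ≤ strictChainCount a (M + N) c := by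
  induction N generalizing c with
  | zero =>
    by_cases h : b = c ∧ StrictMono c
    · simp [strictChainCount, h]
    · simp [strictChainCount, h]
  | succ N ih =>
    by_cases h : StrictMono c
    · simp only [strictChainCount, h, if_true, Finset.mul_sum]
      exact Finset.sum_le_sum fun i _ => ih _
    · simp [strictChainCount, h]

theorem exists_strictMono_update_add_one {a b : Fin n → ℤ} (ha : StrictMono a)
    (hb : StrictMono b) (hab : a < b) :
    ∃ i, StrictMono (Function.update a i (a i + 1)) ∧ Function.update a i (a i + 1) ≤ b := by
  obtain ⟨hle, i₀, hi₀⟩ := Pi.lt_def.1 hab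
  obtain ⟨i, hi, hmax⟩ := (Finset.univ.filter fun i => a i < b i).exists_maximal
    ⟨i₀, by simpa using hi₀⟩
  simp only [Finset.mem_filter, Finset.mem_univ, true_and] at hi hmax
  refine ⟨i, fun j k hjk => ?_, ?_⟩
  · have hlt := ha hjk
    simp only [Function.update_apply]
    split_ifs with h1 h2 h2
    · omega
    · subst h1
      have hk : ¬ a k < b k := fun h => absurd (hmax h hjk.le) (not_le.2 hjk)
      have := hb hjk
      have := hle k
      omega
    · subst h2; omega
    · exact hlt
  · rw [update_le_iff]
    exact ⟨by omega, fun j _ => hle j⟩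

theorem one_le_strictChainCount {a b : Fin n → ℤ} (ha : StrictMono a) (hb : StrictMono b)
    (hab : a ≤ b) {N : ℕ} (hN : (N : ℤ) = ∑ i, (b i - a i)) : 1 ≤ strictChainCount a N b := by
  induction N generalizing a with
  | zero =>
    have h := (Finset.sum_eq_zero_iff_of_nonneg fun i _ => sub_nonneg.2 (hab i)).1
      (by simpa using hN.symm)
    have : a = b := funext fun i => by have := h i (Finset.mem_univ i); omega
    simp [strictChainCount, this, hb]
  | succ N ih =>
    have hne : a ≠ b := by
      rintro rfl
      simp at hN
      omega
    obtain ⟨i, hi, hib⟩ := exists_strictMono_update_add_one ha hb (lt_of_le_of_ne hab hne)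
    have hsum : ∑ j, Function.update a i (a i + 1) j = ∑ j, a j + 1 := by
      rw [Finset.sum_update_of_mem (Finset.mem_univ i),
        ← Finset.add_sum_erase _ _ (Finset.mem_univ i), Finset.sdiff_singleton_eq_erase]
      ring
    have h1 := ih hi hib (by
      rw [Finset.sum_sub_distrib, hsum]
      rw [Finset.sum_sub_distrib] at hN
      push_cast at hN
      linarith)
    have h2 : 1 ≤ strictChainCount a 1 (Function.update a i (a i + 1)) := by
      simp only [strictChainCount, hi, if_true]
      refine le_trans ?_ (Finset.single_le_sum (fun _ _ => Nat.zero_le _) (Finset.mem_univ i))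
      simp [ha]
    have h3 := strictChainCount_mul_le a (Function.update a i (a i + 1)) b 1 N
    rw [add_comm 1 N] at h3
    exact (Nat.mul_le_mul h2 h1).trans h3

theorem StrictMono.add_sub_le_of_le {d : Fin n → ℤ} (hd : StrictMono d) {i j : Fin n}
    (hij : i ≤ j) : d i + ((j : ℤ) - (i : ℤ)) ≤ d j := by
  obtain ⟨k, hk⟩ := Nat.exists_eq_add_of_le (Fin.le_def.1 hij)
  induction k generalizing j with
  | zero =>
    obtain rfl : j = i := Fin.ext hk
    simp
  | succ k ih =>
    have hlt : (i : ℕ) + k < n := by omega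
    have h1 := ih (j := ⟨i + k, hlt⟩) (Fin.le_def.2 (by simp)) rfl
    have h2 : d ⟨i + k, hlt⟩ < d j := hd (Fin.lt_def.2 (by simp; omega))
    simp only at h1
    omega

theorem Matrix.det_vandermonde_natCast (n : ℕ) :
    (Matrix.vandermonde fun i : Fin n => ((i : ℕ) : ℤ)).det =
      ∏ i : Fin n, (((i : ℕ).factorial : ℕ) : ℤ) := by
  cases n with
  | zero => simp
  | succ n =>
    rw [Matrix.det_vandermonde_id_eq_superFactorial, ← Nat.prod_range_succ_factorial,
      ← Nat.cast_prod, Fin.prod_univ_eq_prod_range fun i => i.factorial]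

theorem StrictMono.exists_update_sub_one_eq {d : Fin n → ℤ} (hd : StrictMono d) {i : Fin n}
    (hi : ¬ StrictMono (Function.update d i (d i - 1))) : ∃ j, j ≠ i ∧ d j = d i - 1 := by
  by_contra! h
  refine hi fun j k hjk => ?_
  have hlt := hd hjk
  simp only [Function.update_apply]
  split_ifs with h1 h2 h2
  · omega
  · subst h1; omega
  · subst h2
    have := h j h1
    omega
  · exact hlt

/-- Frobenius' formula for the number of saturated chains from `c, c + 1, …` to `d`. -/
theorem strictChainCount_mul_prod_factorial (c : ℤ) (N : ℕ) {d : Fin n → ℤ} (hd : StrictMono d)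
    (hc : ∀ i, c ≤ d i) (hN : (N : ℤ) = ∑ i, (d i - c - (i : ℤ))) :
    (strictChainCount (fun i : Fin n => c + (i : ℤ)) N d : ℤ) *
        ∏ i, (((d i - c).toNat.factorial : ℕ) : ℤ) =
      N.factorial * (Matrix.vandermonde fun i => d i - c).det := by
  induction N generalizing d with
  | zero =>
    have hle (i : Fin n) : c + (i : ℤ) ≤ d i := by
      have h := hd.add_sub_le_of_le (i := ⟨0, i.pos⟩) (j := i) (Fin.le_def.2 (Nat.zero_le _))
      have := hc ⟨0, i.pos⟩
      simp only [Nat.cast_zero, sub_zero] at h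
      omega
    have hnn (i : Fin n) : 0 ≤ d i - c - (i : ℤ) := by
      have := hle i
      omega
    have h := (Finset.sum_eq_zero_iff_of_nonneg (s := Finset.univ) fun i _ => hnn i).1
      (by rw [← hN, Nat.cast_zero])
    obtain rfl : (fun i : Fin n => c + (i : ℤ)) = d := funext fun i => by
      have := h i (Finset.mem_univ i)
      omega
    simp [strictChainCount, hd, Matrix.det_vandermonde_natCast]
  | succ N ih =>
    have key (i : Fin n) :
        (strictChainCount (fun i : Fin n => c + (i : ℤ)) N (Function.update d i (d i - 1)) : ℤ) *
          ∏ i, (((d i - c).toNat.factorial : ℕ) : ℤ) =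
        N.factorial * ((d i - c) * (Matrix.vandermonde (Function.update (fun i => d i - c) i
          (d i - c - 1))).det) := by
      by_cases hs : StrictMono (Function.update d i (d i - 1))
      · rcases (hc i).eq_or_lt with hci | hci
        · rw [strictChainCount_eq_zero_of_not_le, hci]
          · simp
          · intro h
            have := h i
            simp only [Function.update_self] at this
            omega
        · have hc' (j : Fin n) : c ≤ Function.update d i (d i - 1) j := by
            rw [Function.update_apply]
            split_ifs
            · omega
            · exact hc j
          have hupd : (fun j => Function.update d i (d i - 1) j - c) =
              Function.update (fun i => d i - c) i (d i - c - 1) := by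
            ext j
            simp only [Function.update_apply]
            split_ifs
            · omega
            · rfl
          have hsum : (N : ℤ) = ∑ j, (Function.update d i (d i - 1) j - c - (j : ℤ)) := by
            rw [Finset.sum_sub_distrib, hupd, Finset.sum_update_of_mem (Finset.mem_univ i),
              Finset.sdiff_singleton_eq_erase]
            rw [Finset.sum_sub_distrib, ← Finset.add_sum_erase _ _ (Finset.mem_univ i)] at hN
            push_cast at hN
            linarith
          have h := ih hs hc' hsum
          rw [hupd] at h
          have hfac : ∏ j, (((d j - c).toNat.factorial : ℕ) : ℤ) = (d i - c) *
              ∏ j, (((Function.update d i (d i - 1) j - c).toNat.factorial : ℕ) : ℤ) := by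
            rw [← Finset.mul_prod_erase _ _ (Finset.mem_univ i),
              ← Finset.mul_prod_erase (a := i) (f := fun j =>
                (((Function.update d i (d i - 1) j - c).toNat.factorial : ℕ) : ℤ))
                _ (h := Finset.mem_univ i), ← mul_assoc]
            congr 1
            · obtain ⟨m, hm⟩ : ∃ m : ℕ, d i - c = m + 1 := ⟨(d i - c - 1).toNat, by omega⟩
              have h1 : (d i - c).toNat = m + 1 := by omega
              have h2 : (d i - 1 - c).toNat = m := by omega
              rw [Function.update_self, h1, h2, hm, Nat.factorial_succ]
              push_cast
              ring
            · refine Finset.prod_congr rfl fun j hj => ?_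
              rw [Function.update_of_ne (Finset.ne_of_mem_erase hj)]
          rw [hfac, mul_left_comm, h]
          ring
      · obtain ⟨j, hji, hj⟩ := hd.exists_update_sub_one_eq hs
        rw [strictChainCount_eq_zero_of_not_strictMono _ _ hs,
          Matrix.det_vandermonde_eq_zero_iff.2 ⟨i, j, ?_, hji.symm⟩]
        · simp
        · rw [Function.update_self, Function.update_of_ne hji, hj]
          omega
    simp only [strictChainCount, hd, if_true, Nat.cast_sum]
    rw [Finset.sum_mul, Finset.sum_congr rfl fun i _ => key i, ← Finset.mul_sum,
      Matrix.sum_mul_det_vandermonde_update, ← hN, Nat.factorial_succ]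
    push_cast
    ring

theorem strictChainCount_rectangle (p k : ℕ) (c : ℤ) :
    strictChainCount (fun i : Fin (p + 1) => c + (i : ℤ)) ((p + 1) * k) (fun i => c + k + (i : ℤ)) *
        ∏ i ∈ Finset.range (p + 1), (k + i).factorial =
      ((p + 1) * k).factorial * ∏ i ∈ Finset.range (p + 1), i.factorial := by
  have h := strictChainCount_mul_prod_factorial (n := p + 1) c ((p + 1) * k)
    (d := fun i => c + k + (i : ℤ)) (fun i j hij => by simpa using hij)
    (fun i => by omega) (by
      have h (i : Fin (p + 1)) : c + k + (i : ℤ) - c - (i : ℤ) = k := by ring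
      simp [h])
  have h1 (i : ℕ) : c + k + (i : ℤ) - c = i + k := by ring
  have h2 (i : ℕ) : ((i : ℤ) + k).toNat = k + i := by omega
  simp only [h1, h2, Matrix.det_vandermonde_add, Matrix.det_vandermonde_natCast] at h
  rw [← Fin.prod_univ_eq_prod_range fun i => (k + i).factorial,
    ← Fin.prod_univ_eq_prod_range fun i => i.factorial]
  exact_mod_cast h

/-- Saturated chains of length `N` from `a` to `b` in the poset of strictly increasing integer
sequences. -/
def strictChains (a : Fin n → ℤ) (N : ℕ) (b : Fin n → ℤ) : Set (Fin (N + 1) → Fin n → ℤ) :=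
  {c | c 0 = a ∧ c (Fin.last N) = b ∧ (∀ j, StrictMono (c j)) ∧
    ∀ j : Fin N, ∃ i, c j.castSucc = Function.update (c j.succ) i (c j.succ i - 1)}

theorem strictChains_zero (a b : Fin n → ℤ) :
    strictChains a 0 b = {c | c = (fun _ => a) ∧ a = b ∧ StrictMono b} := by
  ext c
  simp only [strictChains, Set.mem_ofPred_eq, IsEmpty.forall_iff, and_true]
  constructor
  · rintro ⟨rfl, rfl, h⟩
    exact ⟨funext fun j => congrArg c (Fin.eq_zero j), rfl, h _⟩
  · rintro ⟨rfl, rfl, h⟩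
    exact ⟨rfl, rfl, fun _ => h⟩

theorem strictChains_succ (a : Fin n → ℤ) (N : ℕ) {b : Fin n → ℤ} (hb : StrictMono b) :
    strictChains a (N + 1) b = ⋃ i, (fun c => Fin.snoc (α := fun _ => Fin n → ℤ) c b) ''
      strictChains a N (Function.update b i (b i - 1)) := by
  ext c
  simp only [strictChains, Set.mem_ofPred_eq, Set.mem_iUnion, Set.mem_image]
  constructor
  · rintro ⟨h0, hl, hs, hc⟩
    obtain ⟨i, hi⟩ := hc (Fin.last N)
    rw [Fin.succ_last, hl] at hi
    refine ⟨i, Fin.init c, ⟨h0, hi, fun j => hs _, fun j => hc j.castSucc⟩, ?_⟩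
    rw [← hl]
    exact Fin.snoc_init_self c
  · rintro ⟨i, c, ⟨h0, hl, hs, hc⟩, rfl⟩
    refine ⟨?_, Fin.snoc_last _ _, ?_, ?_⟩
    · rw [← Fin.castSucc_zero, Fin.snoc_castSucc, h0]
    · refine Fin.lastCases ?_ fun j => ?_
      · rwa [Fin.snoc_last]
      · rw [Fin.snoc_castSucc]
        exact hs j
    · refine Fin.lastCases ?_ fun j => ?_
      · refine ⟨i, ?_⟩
        rw [Fin.snoc_castSucc, Fin.succ_last, Fin.snoc_last, hl]
      · obtain ⟨i, hi⟩ := hc j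
        refine ⟨i, ?_⟩
        rw [Fin.snoc_castSucc, Fin.succ_castSucc, Fin.snoc_castSucc, hi]

theorem encard_strictChains (a : Fin n → ℤ) (N : ℕ) (b : Fin n → ℤ) :
    (strictChains a N b).encard = strictChainCount a N b := by
  induction N generalizing b with
  | zero =>
    rw [strictChains_zero]
    by_cases h : a = b ∧ StrictMono b
    · simp [strictChainCount, h]
    · simp [strictChainCount, h]
  | succ N ih =>
    by_cases hb : StrictMono b
    · have hinj : Function.Injective fun c : Fin (N + 1) → Fin n → ℤ =>
          Fin.snoc (α := fun _ => Fin n → ℤ) c b :=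
        Fin.snoc_left_injective (α := fun _ => Fin n → ℤ) b
      rw [strictChains_succ a N hb, Set.encard_iUnion_of_finite]
      · simp only [hinj.encard_image, ih, strictChainCount, hb, if_true]
        rw [finsum_eq_sum_of_fintype]
        push_cast
        rfl
      · intro i j hij
        simp only [Function.onFun]
        rw [Set.disjoint_image_iff hinj, Set.disjoint_left]
        intro c hc hc'
        have h := congrFun (hc.2.1.symm.trans hc'.2.1) i
        rw [Function.update_self, Function.update_of_ne hij] at h
        omega
    · have : strictChains a (N + 1) b = ∅ := by
        refine Set.eq_empty_of_forall_notMem fun c hc => hb ?_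
        rw [← hc.2.1]
        exact hc.2.2.1 _
      simp [this, strictChainCount, hb]

theorem BSPoset_covBy_iff {p : ℕ} {dl du : Fin (p + 1) → ℤ} {x y : BSPoset p dl du} :
    x ⋖ y ↔ ∃ i, x.1 = Function.update y.1 i (y.1 i - 1) := by
  constructor
  · intro h
    obtain ⟨i, hi, hle⟩ := exists_strictMono_update_add_one x.2.1 y.2.1 h.lt
    have hx : x.1 < Function.update x.1 i (x.1 i + 1) := by simp
    have hz : Function.update x.1 i (x.1 i + 1) ∈ BSPoset p dl du :=
      ⟨hi, fun j => ⟨(x.2.2 j).1.trans (hx.le j), (hle j).trans (y.2.2 j).2⟩⟩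
    have hy : Function.update x.1 i (x.1 i + 1) = y.1 := by
      by_contra hne
      exact h.2 (c := ⟨_, hz⟩) hx (show _ < y.1 from lt_of_le_of_ne hle hne)
    refine ⟨i, ?_⟩
    rw [← hy]
    simp
  · rintro ⟨i, hi⟩
    have hxy : x.1 < y.1 := by rw [hi]; simp
    refine ⟨hxy, fun z hxz hzy => ?_⟩
    have hxz' : x.1 < z.1 := hxz
    have hzy' : z.1 < y.1 := hzy
    have hne (j : Fin (p + 1)) (hj : j ≠ i) : x.1 j = y.1 j := by
      rw [hi, Function.update_of_ne hj]
    have hii : x.1 i = y.1 i - 1 := by rw [hi, Function.update_self]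
    obtain ⟨j, hj⟩ := (Pi.lt_def.1 hxz').2
    obtain ⟨k, hk⟩ := (Pi.lt_def.1 hzy').2
    have h1 : z.1 j ≤ y.1 j := hzy'.le j
    have h2 : x.1 k ≤ z.1 k := hxz'.le k
    by_cases hji : j = i
    · subst hji
      by_cases hkj : k = j
      · subst hkj; omega
      · have := hne k hkj; omega
    · have := hne j hji; omega

end StrictChainCount

theorem ncard_BSMaxChains (p N : ℕ) (dl du : Fin (p + 1) → ℤ) :
    (BSMaxChains p dl du N).ncard = strictChainCount dl N du := by
  have hinj : Function.Injective fun (c : Fin (N + 1) → BSPoset p dl du) j => (c j).1 :=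
    Subtype.val_injective.comp_left
  have himage : (fun (c : Fin (N + 1) → BSPoset p dl du) j => (c j).1) '' BSMaxChains p dl du N =
      strictChains dl N du := by
    ext c
    constructor
    · rintro ⟨c, ⟨h0, hl, hc⟩, rfl⟩
      exact ⟨h0, hl, fun j => (c j).2.1, fun j => BSPoset_covBy_iff.1 (hc j)⟩
    · rintro ⟨h0, hl, hs, hc⟩
      have hmono : Monotone c := Fin.monotone_iff_le_succ.2 fun j => by
        obtain ⟨i, hi⟩ := hc j
        rw [hi, update_le_self_iff]
        omega
      refine ⟨fun j => ⟨c j, hs j, fun i => ⟨?_, ?_⟩⟩, ⟨h0, hl, fun j => ?_⟩, rfl⟩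
      · rw [← h0]
        exact hmono (Fin.zero_le j) i
      · rw [← hl]
        exact hmono (Fin.le_last j) i
      · exact BSPoset_covBy_iff.2 (hc j)
  rw [← Set.ncard_image_of_injective _ hinj, himage, Set.ncard, encard_strictChains,
    ENat.toNat_natCast]

/-- Enlarging an interval of strictly increasing sequences does not decrease the number of
maximal chains. -/
theorem strictChainCount_mono {n : ℕ} {a a' b b' : Fin n → ℤ} (ha : StrictMono a)
    (hb : StrictMono b) (ha' : StrictMono a') (hb' : StrictMono b') (haa : a' ≤ a)
    (hbb : b ≤ b') {N N' : ℕ} (hN : (N : ℤ) = ∑ i, (b i - a i))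
    (hN' : (N' : ℤ) = ∑ i, (b' i - a' i)) :
    strictChainCount a N b ≤ strictChainCount a' N' b' := by
  obtain ⟨L, hL⟩ := Int.eq_ofNat_of_zero_le
    (Finset.sum_nonneg fun i (_ : i ∈ Finset.univ) => sub_nonneg.2 (haa i))
  obtain ⟨M, hM⟩ := Int.eq_ofNat_of_zero_le
    (Finset.sum_nonneg fun i (_ : i ∈ Finset.univ) => sub_nonneg.2 (hbb i))
  obtain rfl : N' = L + N + M := by
    simp only [Finset.sum_sub_distrib] at hL hM hN hN'
    omega
  calc strictChainCount a N b = 1 * strictChainCount a N b * 1 := by ring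
    _ ≤ strictChainCount a' L a * strictChainCount a N b * strictChainCount b M b' := by
      gcongr
      · exact one_le_strictChainCount ha' ha haa hL.symm
      · exact one_le_strictChainCount hb hb' hbb hM.symm
    _ ≤ strictChainCount a' (L + N) b * strictChainCount b M b' := by
      gcongr
      exact strictChainCount_mul_le _ _ _ _ _
    _ ≤ _ := strictChainCount_mul_le _ _ _ _ _

theorem stmt_10 (p : ℕ) (dl du : Fin (p+1) → ℤ)
    (hdl : StrictMono dl) (hdu : StrictMono du) (hle : ∀ i, dl i ≤ du i) :
    let N : ℕ := (∑ i, (du i - dl i)).toNat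
    let n : ℕ := (BSMaxChains p dl du N).ncard
    let k₂ : ℕ := (du (Fin.last p) - dl 0 - p).toNat
    (n * ∏ i ∈ Finset.range (p+1), Nat.factorial (k₂ + i) ≤
        Nat.factorial ((p+1) * k₂) * ∏ i ∈ Finset.range (p+1), Nat.factorial i) ∧
    (0 ≤ du 0 - dl (Fin.last p) + p →
      let k₁ : ℕ := (du 0 - dl (Fin.last p) + p).toNat
      Nat.factorial ((p+1) * k₁) * ∏ i ∈ Finset.range (p+1), Nat.factorial i ≤
        n * ∏ i ∈ Finset.range (p+1), Nat.factorial (k₁ + i)) := by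
  intro N n k₂
  have hn : n = strictChainCount dl N du := ncard_BSMaxChains p N dl du
  have hN : (N : ℤ) = ∑ i, (du i - dl i) :=
    Int.toNat_of_nonneg (Finset.sum_nonneg fun i _ => sub_nonneg.2 (hle i))
  have hrect (c : ℤ) : StrictMono fun i : Fin (p + 1) => c + (i : ℤ) := fun i j hij => by
    simpa using hij
  have hcard (c : ℤ) (k : ℕ) : (((p + 1) * k : ℕ) : ℤ) =
      ∑ i : Fin (p + 1), (c + k + (i : ℤ) - (c + (i : ℤ))) := by
    have h (i : Fin (p + 1)) : c + k + (i : ℤ) - (c + (i : ℤ)) = k := by ring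
    simp [h]
  have hl0 (i : Fin (p + 1)) := hdl.add_sub_le_of_le (Fin.zero_le i)
  have hll (i : Fin (p + 1)) := hdl.add_sub_le_of_le (Fin.le_last i)
  have hu0 (i : Fin (p + 1)) := hdu.add_sub_le_of_le (Fin.zero_le i)
  have hul (i : Fin (p + 1)) := hdu.add_sub_le_of_le (Fin.le_last i)
  simp only [Fin.val_zero, Fin.val_last, Nat.cast_zero, sub_zero] at hl0 hll hu0 hul
  refine ⟨?_, ?_⟩
  · have hk : (k₂ : ℤ) = du (Fin.last p) - dl 0 - p := Int.toNat_of_nonneg (by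
      have := hle 0
      have := hu0 (Fin.last p)
      simp only [Fin.val_last] at this
      omega)
    rw [hn, ← strictChainCount_rectangle p k₂ (dl 0)]
    gcongr
    refine strictChainCount_mono hdl hdu (hrect _) (hrect _) hl0 (fun i => ?_) hN (hcard _ _)
    have := hul i
    simp only
    omega
  · intro hk₁ k₁
    have hk : (k₁ : ℤ) = du 0 - dl (Fin.last p) + p := Int.toNat_of_nonneg hk₁
    rw [hn, ← strictChainCount_rectangle p k₁ (dl (Fin.last p) - p)]
    gcongr
    refine strictChainCount_mono (hrect _) (hrect _) hdl hdu (fun i => ?_) (fun i => ?_)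
      (hcard _ _) hN
    · have := hll i
      simp only
      omega
    · have := hu0 i
      simp only
      omega
end

section
/- Let a and b be two distinct atoms of the Boij-Söderberg poset Π_{d̲,d̄}. Then the componentwise maximum z of a and b (i.e., z_i = max(a_i, b_i)) lies in Π_{d̲,d̄}, is the least upper bound of a and b, and covers both a and b. In particular, whenever a, b ≤ y for some y ∈ Π_{d̲,d̄}, there is an element z covering both a and b with z ≤ y. -/
/-- The Boij-Söderberg poset is closed under componentwise maxima and minima. -/
def BSPoset.sublattice (p : ℕ) (dl du : Fin (p+1) → ℤ) : Sublattice (Fin (p+1) → ℤ) where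
  carrier := BSPoset p dl du
  supClosed' := fun _ ha _ hb =>
    ⟨fun _ _ hij => max_lt_max (ha.1 hij) (hb.1 hij),
      fun i => ⟨le_sup_of_le_left (ha.2 i).1, sup_le (ha.2 i).2 (hb.2 i).2⟩⟩
  infClosed' := fun _ ha _ hb =>
    ⟨fun _ _ hij => min_lt_min (ha.1 hij) (hb.1 hij),
      fun i => ⟨le_inf (ha.2 i).1 (hb.2 i).1, inf_le_of_left_le (ha.2 i).2⟩⟩

/-- In a modular lattice, the join of two distinct elements covering a common element
covers both of them. -/
theorem CovBy.covBy_sup_of_ne {α : Type*} [Lattice α] [IsModularLattice α] {a b c : α}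
    (ha : c ⋖ a) (hb : c ⋖ b) (hab : a ≠ b) : a ⋖ a ⊔ b ∧ b ⋖ a ⊔ b := by
  have hinf : a ⊓ b = c := ha.wcovBy.inf_eq hb.wcovBy hab
  subst hinf
  exact ⟨covBy_sup_of_inf_covBy_right hb, covBy_sup_of_inf_covBy_left ha⟩

theorem stmt_13 (p : ℕ) (dl du : Fin (p+1) → ℤ)
    (hdl : StrictMono dl) (hdu : StrictMono du) (hle : ∀ i, dl i ≤ du i)
    (a b : BSPoset p dl du) (hab : a ≠ b)
    (ha : (⟨dl, hdl, fun i => ⟨le_rfl, hle i⟩⟩ : BSPoset p dl du) ⋖ a)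
    (hb : (⟨dl, hdl, fun i => ⟨le_rfl, hle i⟩⟩ : BSPoset p dl du) ⋖ b) :
    ∃ hz : (fun i => max (a.1 i) (b.1 i)) ∈ BSPoset p dl du,
      IsLUB {a, b} (⟨fun i => max (a.1 i) (b.1 i), hz⟩ : BSPoset p dl du) ∧
      a ⋖ (⟨fun i => max (a.1 i) (b.1 i), hz⟩ : BSPoset p dl du) ∧
      b ⋖ (⟨fun i => max (a.1 i) (b.1 i), hz⟩ : BSPoset p dl du) ∧
      ∀ y : BSPoset p dl du, a ≤ y → b ≤ y →
        (⟨fun i => max (a.1 i) (b.1 i), hz⟩ : BSPoset p dl du) ≤ y := by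
  let a' : BSPoset.sublattice p dl du := a
  let b' : BSPoset.sublattice p dl du := b
  have hcov : a' ⋖ a' ⊔ b' ∧ b' ⋖ a' ⊔ b' := CovBy.covBy_sup_of_ne ha hb hab
  exact ⟨(a' ⊔ b').2, isLUB_pair (a := a') (b := b'), hcov.1, hcov.2,
    fun _ hay hby => sup_le (a := a') (b := b') hay hby⟩
end

section
/- The Boij-Söderberg poset Π_{d̲,d̄} is graded (pure): for every N ∈ ℕ, if c : {0,…,N} → Π_{d̲,d̄} is a maximal chain, i.e., c(0) = d̲, c(N) = d̄, and c(j+1) covers c(j) for all 0 ≤ j < N, then N = Σ_{i=0}^{p} (d̄_i − d̲_i). -/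
/-- Between comparable distinct strictly increasing integer sequences, the smaller one can be
raised by one at a single index while staying strictly increasing and below the larger one. -/
theorem StrictMono.exists_update_add_one_le {n : ℕ} {d e : Fin n → ℤ} (hd : StrictMono d)
    (he : StrictMono e) (hlt : d < e) :
    ∃ i, StrictMono (Function.update d i (d i + 1)) ∧ Function.update d i (d i + 1) ≤ e := by
  obtain ⟨hle, k, hk⟩ := Pi.lt_def.1 hlt
  obtain ⟨i, hi⟩ := (Set.toFinite {i | d i < e i}).exists_maximal ⟨k, hk⟩
  have hi_lt : d i < e i := hi.prop
  refine ⟨i, fun a b hab => ?_, fun a => ?_⟩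
  · have hdab := hd hab
    rcases eq_or_ne a i with rfl | ha
    · have hb : ¬ d b < e b := fun h => hi.not_prop_of_gt hab h
      have heab := he hab
      simp only [Function.update_self, Function.update_of_ne hab.ne']
      omega
    · rw [Function.update_of_ne ha]
      rcases eq_or_ne b i with rfl | hb
      · rw [Function.update_self]
        omega
      · rwa [Function.update_of_ne hb]
  · rcases eq_or_ne a i with rfl | ha
    · rw [Function.update_self]
      exact Int.add_one_le_of_lt hi_lt
    · rw [Function.update_of_ne ha]
      exact hle a

theorem BSPoset.sum_eq_of_covBy {p : ℕ} {dl du : Fin (p+1) → ℤ} {d e : BSPoset p dl du}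
    (h : d ⋖ e) : ∑ i, (e : Fin (p+1) → ℤ) i = ∑ i, (d : Fin (p+1) → ℤ) i + 1 := by
  obtain ⟨i, hmono, hle⟩ := d.2.1.exists_update_add_one_le e.2.1 (Subtype.coe_lt_coe.2 h.lt)
  have hlt : (d : Fin (p+1) → ℤ) < Function.update d i ((d : Fin (p+1) → ℤ) i + 1) :=
    lt_update_self_iff.2 (lt_add_one _)
  let z : BSPoset p dl du := ⟨_, hmono, fun a =>
    ⟨(d.2.2 a).1.trans (hlt.le a), (hle a).trans (e.2.2 a).2⟩⟩
  have hze : z = e := (h.eq_or_eq (c := z) hlt.le hle).resolve_left (ne_of_gt hlt)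
  rw [← hze, Finset.sum_update_of_mem (Finset.mem_univ i),
    ← Finset.add_sum_erase _ _ (Finset.mem_univ i), Finset.sdiff_singleton_eq_erase]
  ring

theorem stmt_14 (p : ℕ) (dl du : Fin (p+1) → ℤ)
    (hdl : StrictMono dl) (hdu : StrictMono du) (hle : ∀ i, dl i ≤ du i)
    (N : ℕ) (c : Fin (N+1) → BSPoset p dl du)
    (h0 : (c 0 : Fin (p+1) → ℤ) = dl) (hN : (c (Fin.last N) : Fin (p+1) → ℤ) = du)
    (hcov : ∀ j : Fin N, c j.castSucc ⋖ c j.succ) :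
    (N : ℤ) = ∑ i, (du i - dl i) := by
  have hsum : ∀ j : Fin (N+1), ∑ i, (c j : Fin (p+1) → ℤ) i = ∑ i, dl i + (j : ℕ) := by
    intro j
    induction j using Fin.induction with
    | zero => simp [h0]
    | succ j ih =>
      rw [BSPoset.sum_eq_of_covBy (hcov j), ih]
      push_cast [Fin.val_castSucc, Fin.val_succ]
      ring
  have hlast := hsum (Fin.last N)
  rw [hN, Fin.val_last] at hlast
  rw [Finset.sum_sub_distrib, hlast]
  ring
end
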